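/- Let G₁₄ be the subgroup of G₁₁ generated by s and t. Then z⁴ = (s·t·u)⁴ = s·t·s·t·s·t·s·t = t·s·t·s·t·s·t·s, the center of G₁₄ equals the cyclic subgroup generated by z⁴ (which has order 6), and Z(G₁₄) = G₁₄ ∩ Z(G₁₁); moreover, with Z₁₄ = {1, z⁴, z⁸, z¹², z¹⁶, z²⁰}, T = {1, t, t²}, and X₁₄ = {1, s, s·t, s·t·s, s·t·s·t, s·t·s·t·s, s·t·s·t², s·t·s·t²·s}, the map Z₁₄ × T × X₁₄ → G₁₄ sending (y, v, x) to y·v·x is a bijection onto G₁₄. -/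

import Mathlib

open Pointwise

namespace Octa

def rels : Set (FreeGroup (Fin 3)) :=
  { FreeGroup.of 0 ^ 2, FreeGroup.of 1 ^ 3, FreeGroup.of 2 ^ 4,
    FreeGroup.of 0 * FreeGroup.of 1 * FreeGroup.of 2 *
      (FreeGroup.of 1 * FreeGroup.of 2 * FreeGroup.of 0)⁻¹,
    FreeGroup.of 0 * FreeGroup.of 1 * FreeGroup.of 2 *
      (FreeGroup.of 2 * FreeGroup.of 0 * FreeGroup.of 1)⁻¹ }

/-- The group `G₁₁ = ⟨s, t, u | s² = t³ = u⁴ = 1, stu = tus = ust⟩`. -/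
abbrev G11 := PresentedGroup rels

def s : G11 := PresentedGroup.of 0
def t : G11 := PresentedGroup.of 1
def u : G11 := PresentedGroup.of 2
def z : G11 := s * t * u

def G14 : Subgroup G11 := Subgroup.closure {s, t}

/-- The words of `X₁₄` in an arbitrary monoid. -/
def Xw {M : Type*} [Monoid M] (s t : M) : Fin 8 → M :=
  ![1, s, s * t, s * t * s, s * t * s * t, s * t * s * t * s, s * t * s * t ^ 2,
    s * t * s * t ^ 2 * s]

lemma map_Xw {M N : Type*} [Monoid M] [Monoid N] (f : M →* N) (s t : M) (k : Fin 8) :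
    f (Xw s t k) = Xw (f s) (f t) k := by
  fin_cases k <;> simp [Xw]

/-- Three square roots of a central element with product one force `c ^ 6 = 1`. -/
lemma pow_six_aux {G : Type*} [Group G] (p q r c : G) (hc : ∀ g, c * g = g * c)
    (hp : p * p = c) (hq : q * q = c) (hr : r * r = c) (h : p * q * r = 1) : c ^ 6 = 1 := by
  have hr' : r = (p * q)⁻¹ := eq_inv_of_mul_eq_one_right h
  have h1 : p * q * (p * q) * c = 1 := by rw [← hr, hr']; group
  have h2 : p * q = c * c * c * (q * p) := by
    have e : p * (p * q * (p * q) * c) * q = p * q := by rw [h1, mul_one]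
    calc p * q = (p * p) * q * p * (q * c) * q := by rw [← e]; simp only [mul_assoc]
      _ = c * (q * p) * (c * (q * q)) := by rw [hp, ← hc q]; simp only [mul_assoc]
      _ = c * c * c * (q * p) := by
        rw [hq, mul_assoc, show q * p * (c * c) = c * c * (q * p) from
          (((show Commute c (q * p) from hc _).mul_left (hc _)).eq).symm]
        simp only [mul_assoc]
  have h3 : c * q = c ^ 6 * (c * q) := by
    calc c * q = p * (p * q) := by rw [← mul_assoc, hp]
      _ = (p * (c * c * c)) * q * p := by rw [h2]; simp only [mul_assoc]
      _ = (c * c * c) * (p * q) * p := by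
        have : p * (c * c * c) = c * c * c * p :=
          ((((show Commute c p from hc _).mul_left (hc _)).mul_left (hc _)).eq).symm
        rw [this]; simp only [mul_assoc]
      _ = c ^ 6 * (q * (p * p)) := by rw [h2, pow_succ]; simp only [pow_succ, pow_zero, one_mul, mul_assoc]
      _ = c ^ 6 * (c * q) := by rw [hp, hc]
  exact right_eq_mul.mp h3

/-- The consequences of the presentation of `G₁₄`-type groups. -/
lemma pow_six {G : Type*} [Group G] (s t c : G) (hs : s * s = 1) (ht : t * t * t = 1)
    (hc : ∀ g, c * g = g * c) (h : c = t * s * t * s * t * s * t * s) : c ^ 6 = 1 := by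
  have hs' : s⁻¹ = s := inv_eq_of_mul_eq_one_left hs
  have ht' : t⁻¹ = t * t := inv_eq_of_mul_eq_one_left ht
  -- `p = t s t s`, and its conjugates by powers of `t`
  have conj : ∀ g : G, g⁻¹ * c * g = c := fun g => by rw [mul_assoc, hc]; group
  refine pow_six_aux (t⁻¹ * (t * s * t * s) * t) (t⁻¹ * t⁻¹ * (t * s * t * s) * (t * t))
    (t * s * t * s) c hc ?_ ?_ ?_ ?_
  · rw [← conj t, h]; group
  · rw [← conj (t * t), h]; group
  · rw [h]; group
  · have : t⁻¹ * (t * s * t * s) * t * (t⁻¹ * t⁻¹ * (t * s * t * s) * (t * t)) * (t * s * t * s)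
      = s * t * (s * s) * t * s * (t * t * t) * s * t * s := by group
    rw [this, hs, ht]
    have : s * t * 1 * t * s * 1 * s * t * s = s * t * t * (s * s) * t * s := by group
    rw [this, hs]
    have : s * t * t * 1 * t * s = s * (t * t * t) * s := by group
    rw [this, ht, mul_one, hs]

lemma step_t {G : Type*} [Group G] (s t c : G) (hs : s * s = 1) (ht : t * t * t = 1)
    (hc : ∀ g, c * g = g * c) (h : c = t * s * t * s * t * s * t * s)
    (h' : c = s * t * s * t * s * t * s * t) (k : Fin 8) :
    ∃ (i j : ℕ) (k' : Fin 8), Xw s t k * t = c ^ i * t ^ j * Xw s t k' := by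
  have hc6 : c ^ 6 = 1 := pow_six s t c hs ht hc h
  have hs' : s⁻¹ = s := inv_eq_of_mul_eq_one_left hs
  have ht' : t⁻¹ = t * t := inv_eq_of_mul_eq_one_left ht
  have hc5 : c ^ 5 = c⁻¹ := eq_inv_of_mul_eq_one_left (by rw [← pow_succ, hc6])
  have e5 : s * t * s * t * s * t = c * (t ^ 2 * s) := by
    have : s * t * s * t * s * t = c * (t⁻¹ * s⁻¹) := by rw [h']; group
    rw [this, hs', ht', pow_two]
  have hsts : s * t⁻¹ * s = c⁻¹ * (t * s * t * s * t) := by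
    rw [h]
    have : (t * s * t * s * t * s * t * s)⁻¹ * (t * s * t * s * t) = s⁻¹ * t⁻¹ * s⁻¹ := by group
    rw [this, hs']
  fin_cases k
  · exact ⟨0, 1, 0, by simp [Xw]⟩
  · exact ⟨0, 0, 2, by simp [Xw]⟩
  · refine ⟨5, 1, 5, ?_⟩
    have : s * t * t = c⁻¹ * (t * ((s * t * s * t * s * t) * t⁻¹)) := by
      rw [e5, show t * (c * (t ^ 2 * s) * t⁻¹) = (t * c) * (t ^ 2 * s * t⁻¹) by group, ← hc t,
        show c⁻¹ * (c * t * (t ^ 2 * s * t⁻¹)) = (t * t * t) * s * t⁻¹ by simp [pow_two, mul_assoc], ht, ht']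
      group
    simp only [Xw, hc5]
    simpa [mul_assoc] using this
  · exact ⟨0, 0, 4, by simp [Xw]⟩
  · exact ⟨0, 0, 6, by simp [Xw, pow_two, mul_assoc]⟩
  · exact ⟨1, 2, 1, by simpa [Xw, mul_assoc] using e5⟩
  · refine ⟨0, 0, 3, ?_⟩
    have : s * t * s * t ^ 2 * t = s * t * s * (t * t * t) := by simp [pow_two, mul_assoc]
    simpa [Xw, ht] using this
  · refine ⟨2, 2, 7, ?_⟩
    have ht2 : t ^ 2 = t⁻¹ := by rw [ht', pow_two]
    have key : s * t * (s * t⁻¹ * s) = c⁻¹ * c⁻¹ * t * (s * t * (s * t⁻¹ * s)) * t := by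
      have hci : ∀ g, c⁻¹ * g = g * c⁻¹ := fun g => by
        rw [inv_mul_eq_iff_eq_mul, ← mul_assoc, hc, mul_assoc, mul_inv_cancel, mul_one]
      calc s * t * (s * t⁻¹ * s) = (s * t * c⁻¹) * (t * s * t * s * t) := by rw [hsts]; group
        _ = c⁻¹ * (s * (t * t) * s) * t * s * t := by rw [← hci]; group
        _ = c⁻¹ * c⁻¹ * t * s * t * s * (t * t) * s * t := by rw [← ht', hsts, ht']; group
        _ = _ := by rw [← ht']; group
    have : s * t * (s * t⁻¹ * s) * t = c ^ 2 * t⁻¹ * (s * t * (s * t⁻¹ * s)) := by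
      have hc2 : c ^ 2 * t⁻¹ = t⁻¹ * c ^ 2 := by rw [pow_two, mul_assoc, hc t⁻¹, ← mul_assoc, hc t⁻¹, mul_assoc]
      conv_rhs => rw [key, hc2]
      group
    simp only [Xw]
    simpa [ht2, mul_assoc] using this

lemma step_s {G : Type*} [Group G] (s t c : G) (hs : s * s = 1) (k : Fin 8) :
    ∃ (i j : ℕ) (k' : Fin 8), Xw s t k * s = c ^ i * t ^ j * Xw s t k' := by
  refine ⟨0, 0, ![1, 0, 3, 2, 5, 4, 7, 6] k, ?_⟩
  fin_cases k <;> simp [Xw, mul_assoc, hs]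

abbrev Mat := Matrix (Fin 2) (Fin 2) (ZMod 73)

def mS : Mat := !![1, 0; 0, 72]
def mT : Mat := !![21, 1; 57, 44]
def mU : Mat := !![55, 56; 20, 65]
def mC : Mat := !![65, 0; 0, 65]

def uS : Matˣ := ⟨mS, mS, by decide +kernel, by decide +kernel⟩
def uT : Matˣ := ⟨mT, mT ^ 2, by decide +kernel, by decide +kernel⟩
def uU : Matˣ := ⟨mU, mU ^ 3, by decide +kernel, by decide +kernel⟩

lemma mat_inj : ∀ (i : Fin 6) (j : Fin 3) (k k' : Fin 8),
    mC ^ (i : ℕ) * mT ^ (j : ℕ) * Xw mS mT k = Xw mS mT k' → i = 0 ∧ j = 0 ∧ k = k' := by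
  decide +kernel

lemma mat_center : ∀ (j : Fin 3) (k : Fin 8),
    mT ^ (j : ℕ) * Xw mS mT k * mS = mS * (mT ^ (j : ℕ) * Xw mS mT k) →
    mT ^ (j : ℕ) * Xw mS mT k * mT = mT * (mT ^ (j : ℕ) * Xw mS mT k) → j = 0 ∧ k = 0 := by
  decide +kernel


def gens : Fin 3 → Matˣ := ![uS, uT, uU]

lemma gens_rels : ∀ r ∈ rels, FreeGroup.lift gens r = 1 := by
  intro r hr
  simp only [rels, Set.mem_insert_iff, Set.mem_singleton_iff] at hr
  rcases hr with rfl | rfl | rfl | rfl | rfl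
  · simp only [map_pow, FreeGroup.lift_apply_of]
    exact Units.ext (by decide +kernel)
  · simp only [map_pow, FreeGroup.lift_apply_of]
    exact Units.ext (by decide +kernel)
  · simp only [map_pow, FreeGroup.lift_apply_of]
    exact Units.ext (by decide +kernel)
  · simp only [map_mul, map_inv, FreeGroup.lift_apply_of]
    exact mul_inv_eq_one.mpr (Units.ext (by decide +kernel))
  · simp only [map_mul, map_inv, FreeGroup.lift_apply_of]
    exact mul_inv_eq_one.mpr (Units.ext (by decide +kernel))

/-- The reduction modulo 73 of the reflection representation. -/
def rep : G11 →* Mat := (Units.coeHom Mat).comp (PresentedGroup.toGroup gens_rels)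

lemma rep_s : rep s = mS := by
  simp only [rep, s, MonoidHom.comp_apply, PresentedGroup.toGroup.of]; rfl

lemma rep_t : rep t = mT := by
  simp only [rep, t, MonoidHom.comp_apply, PresentedGroup.toGroup.of]; rfl

lemma rel_one {r : FreeGroup (Fin 3)} (h : r ∈ rels) : PresentedGroup.mk rels r = 1 :=
  PresentedGroup.one_of_mem h

lemma hs : s * s = 1 := by
  have := rel_one (r := FreeGroup.of 0 ^ 2) (by simp [rels])
  rw [map_pow, pow_two] at this
  exact this

lemma ht : t * t * t = 1 := by
  have := rel_one (r := FreeGroup.of 1 ^ 3) (by simp [rels])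
  rw [map_pow, pow_succ, pow_two] at this
  exact this

lemma hu : u ^ 4 = 1 := by
  have := rel_one (r := FreeGroup.of 2 ^ 4) (by simp [rels])
  rw [map_pow] at this
  exact this

lemma hz1 : s * t * u = t * u * s := by
  have := rel_one (r := FreeGroup.of 0 * FreeGroup.of 1 * FreeGroup.of 2 *
      (FreeGroup.of 1 * FreeGroup.of 2 * FreeGroup.of 0)⁻¹) (by simp [rels])
  rw [map_mul, map_inv, mul_inv_eq_one] at this
  exact this

lemma hz2 : s * t * u = u * s * t := by
  have := rel_one (r := FreeGroup.of 0 * FreeGroup.of 1 * FreeGroup.of 2 *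
      (FreeGroup.of 2 * FreeGroup.of 0 * FreeGroup.of 1)⁻¹) (by simp [rels])
  rw [map_mul, map_inv, mul_inv_eq_one] at this
  exact this

lemma zs : z * s = s * z := by
  rw [z]; nth_rw 2 [hz1]; simp only [mul_assoc]

lemma zu : z * u = u * z := by
  rw [z]; nth_rw 1 [hz2]; simp only [mul_assoc]

lemma zt : z * t = t * z := by
  rw [z]; nth_rw 1 [hz1]; rw [hz2]; simp only [mul_assoc]

lemma z_central (g : G11) : z * g = g * z := by
  have hg : g ∈ Subgroup.closure (Set.range (PresentedGroup.of (rels := rels))) := by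
    rw [PresentedGroup.closure_range_of]; trivial
  have hle : Subgroup.closure (Set.range (PresentedGroup.of (rels := rels))) ≤
      Subgroup.centralizer {z} := by
    rw [Subgroup.closure_le]
    rintro _ ⟨i, rfl⟩
    simp only [SetLike.mem_coe, Subgroup.mem_centralizer_singleton_iff]
    fin_cases i
    · exact zs.symm
    · exact zt.symm
    · exact zu.symm
  exact (Subgroup.mem_centralizer_singleton_iff.mp (hle hg)).symm

lemma c_central (g : G11) : z ^ 4 * g = g * z ^ 4 :=
  ((show Commute z g from z_central g).pow_left 4).eq

lemma c_eq_pow : z ^ 4 = (s * t) ^ 4 := by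
  have h : u = (s * t)⁻¹ * z := by rw [z]; group
  have h4 := hu
  rw [h, (show Commute (s * t)⁻¹ z from (z_central _).symm).mul_pow, inv_pow,
    inv_mul_eq_one] at h4
  exact h4.symm

lemma c_eq1 : z ^ 4 = s * t * s * t * s * t * s * t := by
  rw [c_eq_pow]; simp only [pow_succ, pow_zero, one_mul, mul_assoc]

lemma c_eq2 : z ^ 4 = t * s * t * s * t * s * t * s := by
  have h : z ^ 4 = s⁻¹ * (z ^ 4) * s := by rw [mul_assoc, c_central, inv_mul_cancel_left]
  rw [h, c_eq1]; group

lemma rep_c : rep (z ^ 4) = mC := by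
  rw [c_eq_pow, map_pow, map_mul, rep_s, rep_t]; decide +kernel

lemma c_pow_six : (z ^ 4) ^ 6 = 1 := pow_six s t _ hs ht c_central c_eq2

/-- The normal form map. -/
def nf (p : Fin 6 × Fin 3 × Fin 8) : G11 :=
  (z ^ 4) ^ (p.1 : ℕ) * t ^ (p.2.1 : ℕ) * Xw s t p.2.2

lemma t_pow_three : t ^ 3 = 1 := by rw [pow_succ, pow_two, ht]

lemma nf_inj : Function.Injective nf := by
  rintro ⟨i, j, k⟩ ⟨i', j', k'⟩ h
  simp only [nf] at h
  have hc' : (z ^ 4) ^ (6 - (i' : ℕ)) * (z ^ 4) ^ (i' : ℕ) = 1 := by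
    rw [← pow_add, Nat.sub_add_cancel (by omega), c_pow_six]
  have ht' : t ^ (3 - (j' : ℕ)) * t ^ (j' : ℕ) = 1 := by
    rw [← pow_add, Nat.sub_add_cancel (by omega), t_pow_three]
  have hcomm : t ^ (3 - (j' : ℕ)) * (z ^ 4) ^ (6 - (i' : ℕ) + i)
      = (z ^ 4) ^ (6 - (i' : ℕ) + i) * t ^ (3 - (j' : ℕ)) :=
    ((show Commute (z ^ 4) (t ^ (3 - (j' : ℕ))) from c_central _).pow_left _).eq.symm
  have key : (z ^ 4) ^ (6 - (i' : ℕ) + i) * t ^ (3 - (j' : ℕ) + j) * Xw s t k = Xw s t k' := by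
    calc _ = (z ^ 4) ^ (6 - (i' : ℕ) + i) * t ^ (3 - (j' : ℕ)) * t ^ (j : ℕ) * Xw s t k := by
          rw [pow_add t]; simp only [mul_assoc]
      _ = t ^ (3 - (j' : ℕ)) * ((z ^ 4) ^ (6 - (i' : ℕ)) *
            ((z ^ 4) ^ (i : ℕ) * t ^ (j : ℕ) * Xw s t k)) := by
          rw [← hcomm, pow_add]; simp only [mul_assoc]
      _ = t ^ (3 - (j' : ℕ)) * (((z ^ 4) ^ (6 - (i' : ℕ)) * (z ^ 4) ^ (i' : ℕ)) *
            (t ^ (j' : ℕ) * Xw s t k')) := by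
          rw [h]; simp only [mul_assoc]
      _ = (t ^ (3 - (j' : ℕ)) * t ^ (j' : ℕ)) * Xw s t k' := by
          rw [hc', one_mul, mul_assoc]
      _ = _ := by rw [ht', one_mul]
  rw [pow_eq_pow_mod _ c_pow_six, pow_eq_pow_mod _ t_pow_three] at key
  have := congrArg rep key
  simp only [map_mul, map_pow _ t, map_pow _ (z ^ 4), rep_c, rep_t, map_Xw, rep_s] at this
  obtain ⟨h1, h2, h3⟩ := mat_inj ⟨(6 - (i' : ℕ) + i) % 6, Nat.mod_lt _ (by norm_num)⟩
    ⟨(3 - (j' : ℕ) + j) % 3, Nat.mod_lt _ (by norm_num)⟩ k k' this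
  have h1' : (6 - (i' : ℕ) + i) % 6 = 0 := congrArg Fin.val h1
  have h2' : (3 - (j' : ℕ) + j) % 3 = 0 := congrArg Fin.val h2
  have e1 : i = i' := Fin.ext (by omega)
  have e2 : j = j' := Fin.ext (by omega)
  rw [e1, e2, h3]

lemma nf_of_nat (i j : ℕ) (k : Fin 8) : ∃ p, nf p = (z ^ 4) ^ i * t ^ j * Xw s t k := by
  refine ⟨(⟨i % 6, Nat.mod_lt _ (by norm_num)⟩, ⟨j % 3, Nat.mod_lt _ (by norm_num)⟩, k), ?_⟩
  simp only [nf]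
  rw [← pow_eq_pow_mod i c_pow_six, ← pow_eq_pow_mod j t_pow_three]

lemma nf_mul (y : G11) (hy : ∀ k : Fin 8, ∃ (i j : ℕ) (k' : Fin 8),
    Xw s t k * y = (z ^ 4) ^ i * t ^ j * Xw s t k') (p) : ∃ q, nf q = nf p * y := by
  obtain ⟨i, j, k', h⟩ := hy p.2.2
  obtain ⟨q, hq⟩ := nf_of_nat (p.1 + i) (p.2.1 + j) k'
  refine ⟨q, hq.trans ?_⟩
  have hcomm : t ^ (p.2.1 : ℕ) * (z ^ 4) ^ i = (z ^ 4) ^ i * t ^ (p.2.1 : ℕ) :=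
    ((show Commute (z ^ 4) (t ^ (p.2.1 : ℕ)) from c_central _).pow_left i).eq.symm
  calc _ = (z ^ 4) ^ (p.1 : ℕ) * ((z ^ 4) ^ i * t ^ (p.2.1 : ℕ)) * t ^ j * Xw s t k' := by
        rw [pow_add, pow_add]; simp only [mul_assoc]
    _ = (z ^ 4) ^ (p.1 : ℕ) * t ^ (p.2.1 : ℕ) * (Xw s t p.2.2 * y) := by
        rw [← hcomm, h]; simp only [mul_assoc]
    _ = _ := by simp only [nf, mul_assoc]

lemma nf_mul_s (p) : ∃ q, nf q = nf p * s := nf_mul s (step_s s t _ hs) p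

lemma nf_mul_t (p) : ∃ q, nf q = nf p * t :=
  nf_mul t (step_t s t _ hs ht c_central c_eq2 c_eq1) p

lemma s_mem : s ∈ G14 := Subgroup.subset_closure (by simp)
lemma t_mem : t ∈ G14 := Subgroup.subset_closure (by simp)
lemma c_mem : z ^ 4 ∈ G14 := by
  rw [c_eq_pow]; exact G14.pow_mem (G14.mul_mem s_mem t_mem) 4

lemma nf_surj {g : G11} (hg : g ∈ G14) : ∃ p, nf p = g := by
  induction hg using Subgroup.closure_induction_right with
  | one => exact ⟨(0, 0, 0), by simp [nf, Xw]⟩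
  | mul_right x hx y hy ih =>
    obtain ⟨p, rfl⟩ := ih
    rcases hy with rfl | rfl
    · exact nf_mul_s p
    · exact nf_mul_t p
  | mul_inv_cancel x hx y hy ih =>
    obtain ⟨p, rfl⟩ := ih
    rcases hy with rfl | rfl
    · rw [inv_eq_of_mul_eq_one_left hs]
      exact nf_mul_s p
    · obtain ⟨q, hq⟩ := nf_mul_t p
      rw [inv_eq_of_mul_eq_one_left ht, ← mul_assoc, ← hq]
      exact nf_mul_t q

lemma Xw_mem (k : Fin 8) : Xw s t k ∈ G14 := by
  have h := map_Xw G14.subtype ⟨s, s_mem⟩ ⟨t, t_mem⟩ k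
  exact h ▸ SetLike.coe_mem _

lemma nf_mem (p) : nf p ∈ G14 :=
  G14.mul_mem (G14.mul_mem (G14.pow_mem c_mem _) (G14.pow_mem t_mem _)) (Xw_mem _)

lemma order_c : orderOf (z ^ 4) = 6 := by
  rw [orderOf_eq_iff (by norm_num)]
  refine ⟨c_pow_six, fun m hm hm0 h => ?_⟩
  have : nf (⟨m, hm⟩, 0, 0) = nf (0, 0, 0) := by simp [nf, Xw, h]
  have := congrArg (fun p => (p.1 : ℕ)) (nf_inj this)
  simp at this
  omega

lemma center_eq : (Subgroup.center ↥G14).map G14.subtype = Subgroup.zpowers (z ^ 4) := by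
  apply le_antisymm
  · rintro _ ⟨⟨g, hg⟩, hgc, rfl⟩
    obtain ⟨p, rfl⟩ := nf_surj hg
    have hgc' := Subgroup.mem_center_iff.mp hgc
    have hcomm : ∀ y ∈ G14, t ^ (p.2.1 : ℕ) * Xw s t p.2.2 * y
        = y * (t ^ (p.2.1 : ℕ) * Xw s t p.2.2) := by
      intro y hy
      have h1 : y * nf p = nf p * y := congrArg Subtype.val (hgc' ⟨y, hy⟩)
      have h2 : (z ^ 4) ^ (p.1 : ℕ) * y = y * (z ^ 4) ^ (p.1 : ℕ) :=
        ((show Commute (z ^ 4) y from c_central _).pow_left _).eq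
      apply mul_left_cancel (a := (z ^ 4) ^ (p.1 : ℕ))
      calc _ = nf p * y := by simp only [nf, mul_assoc]
        _ = y * (z ^ 4) ^ (p.1 : ℕ) * (t ^ (p.2.1 : ℕ) * Xw s t p.2.2) := by
          rw [← h1]; simp only [nf, mul_assoc]
        _ = _ := by rw [← h2]; simp only [mul_assoc]
    have hS := congrArg rep (hcomm s s_mem)
    have hT := congrArg rep (hcomm t t_mem)
    simp only [map_mul, map_pow, rep_t, map_Xw, rep_s] at hS hT
    obtain ⟨hj, hk⟩ := mat_center _ _ hS hT
    refine ⟨((p.1 : ℕ) : ℤ), ?_⟩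
    simp [nf, hj, hk, Xw]
  · rw [Subgroup.zpowers_le]
    refine ⟨⟨z ^ 4, c_mem⟩, ?_, rfl⟩
    exact Subgroup.mem_center_iff.mpr fun g => Subtype.ext (c_central g).symm

lemma center_inf :
    (Subgroup.center ↥G14).map G14.subtype = G14 ⊓ Subgroup.center G11 := by
  apply le_antisymm
  · rw [center_eq, Subgroup.zpowers_le]
    exact ⟨c_mem, Subgroup.mem_center_iff.mpr fun g => (c_central g).symm⟩
  · rintro g ⟨hg, hgc⟩
    refine ⟨⟨g, hg⟩, ?_, rfl⟩
    exact Subgroup.mem_center_iff.mpr fun h =>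
      Subtype.ext (Subgroup.mem_center_iff.mp hgc h)

lemma Z_eq : ({1, z ^ 4, z ^ 8, z ^ 12, z ^ 16, z ^ 20} : Set G11)
    = Set.range fun i : Fin 6 => (z ^ 4) ^ (i : ℕ) := by
  ext g
  simp only [Set.mem_range, Fin.exists_fin_succ, ← pow_mul]
  simp [eq_comm]

lemma T_eq : ({1, t, t ^ 2} : Set G11) = Set.range fun i : Fin 3 => t ^ (i : ℕ) := by
  ext g
  simp only [Set.mem_range, Fin.exists_fin_succ]
  simp [eq_comm]

lemma X_eq : ({1, s, s * t, s * t * s, s * t * s * t, s * t * s * t * s, s * t * s * t ^ 2,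
    s * t * s * t ^ 2 * s} : Set G11) = Set.range (Xw s t) := by
  ext g
  simp only [Set.mem_range, Fin.exists_fin_succ]
  simp [Xw, eq_comm]


theorem statement16 :
    z ^ 4 = s * t * s * t * s * t * s * t ∧
    z ^ 4 = t * s * t * s * t * s * t * s ∧
    orderOf (z ^ 4) = 6 ∧
    (Subgroup.center ↥G14).map G14.subtype = Subgroup.zpowers (z ^ 4) ∧
    (Subgroup.center ↥G14).map G14.subtype = G14 ⊓ Subgroup.center G11 ∧
    Set.BijOn (fun p : G11 × G11 × G11 => p.1 * p.2.1 * p.2.2)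
      (({1, z ^ 4, z ^ 8, z ^ 12, z ^ 16, z ^ 20} : Set G11) ×ˢ (({1, t, t ^ 2} : Set G11) ×ˢ ({1, s, s * t, s * t * s, s * t * s * t, s * t * s * t * s, s * t * s * t ^ 2, s * t * s * t ^ 2 * s} : Set G11)))
      (G14 : Set G11) := by
  refine ⟨c_eq1, c_eq2, order_c, center_eq, center_inf, ?_⟩
  rw [Z_eq, T_eq, X_eq]
  refine ⟨?_, ?_, ?_⟩
  · rintro ⟨_, _, _⟩ ⟨⟨i, rfl⟩, ⟨j, rfl⟩, ⟨k, rfl⟩⟩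
    exact nf_mem (i, j, k)
  · rintro ⟨_, _, _⟩ ⟨⟨i, hi⟩, ⟨j, hj⟩, ⟨k, hk⟩⟩ ⟨_, _, _⟩ ⟨⟨i', hi'⟩, ⟨j', hj'⟩, ⟨k', hk'⟩⟩ h
    dsimp only at hi hj hk hi' hj' hk'
    subst hi hj hk hi' hj' hk'
    have h' : nf (i, j, k) = nf (i', j', k') := h
    have := nf_inj h'
    simp only [Prod.mk.injEq] at this
    obtain ⟨rfl, rfl, rfl⟩ := this
    rfl
  · intro g hg
    obtain ⟨⟨i, j, k⟩, rfl⟩ := nf_surj hg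
    exact ⟨((z ^ 4) ^ (i : ℕ), t ^ (j : ℕ), Xw s t k), ⟨⟨i, rfl⟩, ⟨j, rfl⟩, ⟨k, rfl⟩⟩, rfl⟩

end Octa
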